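/- There exists a unique unitary operator U : L²(𝕋²) → L²(𝕋²) such that ∫_{𝕋²} U f = ∫_{𝕋²} f for every f ∈ L²(𝕋²) and U(∂_z̄ φ) = ∂_z φ for every C^∞ function φ on 𝕋². Moreover U maps C^∞ functions to C^∞ functions and commutes with ∂/∂x₁ and ∂/∂x₂ on C^∞ functions; explicitly, U e_n = ((n₁ − i n₂)/(n₁ + i n₂))·e_n for n ≠ 0 and U e₀ = e₀. -/

import Mathlib

open MeasureTheory

instance : Fact ((0:ℝ) < 2 * Real.pi) := ⟨by positivity⟩

/-- The two-torus `𝕋² = ℝ²/2πℤ²`. -/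
abbrev T2 : Type := AddCircle (2 * Real.pi) × AddCircle (2 * Real.pi)

/-- The canonical projection `ℝ² → 𝕋²`. -/
noncomputable def projT2 : ℝ × ℝ → T2 := fun p => (↑p.1, ↑p.2)

lemma projT2_surjective : Function.Surjective projT2 := by
  rintro ⟨x, y⟩
  obtain ⟨a, ha⟩ := QuotientAddGroup.mk_surjective x
  obtain ⟨b, hb⟩ := QuotientAddGroup.mk_surjective y
  exact ⟨(a, b), by simp [projT2, ha, hb]⟩

/-- A choice of lift `𝕋² → ℝ²` (a set-theoretic section of `projT2`). -/
noncomputable def liftT2 : T2 → ℝ × ℝ := Function.surjInv projT2_surjective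

/-- A function on the torus is `C^∞` iff its (doubly periodic) lift to `ℝ²` is `C^∞`. -/
def SmoothT2 (F : T2 → ℂ) : Prop := ContDiff ℝ (⊤ : ℕ∞) (F ∘ projT2)

/-- The partial derivative `∂F/∂x₁` of a function on the torus. -/
noncomputable def pd1 (F : T2 → ℂ) : T2 → ℂ := fun q =>
  fderiv ℝ (F ∘ projT2) (liftT2 q) (1, 0)

/-- The partial derivative `∂F/∂x₂` of a function on the torus. -/
noncomputable def pd2 (F : T2 → ℂ) : T2 → ℂ := fun q =>
  fderiv ℝ (F ∘ projT2) (liftT2 q) (0, 1)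

/-- `∂_z = (1/2)(∂/∂x₁ − i ∂/∂x₂)` on the torus (`z = x₁ + i x₂`). -/
noncomputable def dzT2 (F : T2 → ℂ) : T2 → ℂ := fun q =>
  (pd1 F q - Complex.I * pd2 F q) / 2

/-- `∂_z̄ = (1/2)(∂/∂x₁ + i ∂/∂x₂)` on the torus (`z = x₁ + i x₂`). -/
noncomputable def dzbarT2 (F : T2 → ℂ) : T2 → ℂ := fun q =>
  (pd1 F q + Complex.I * pd2 F q) / 2

/-- The character `e_n(x) = e^{i(n₁x₁+n₂x₂)}` on the torus, `n ∈ ℤ²`. -/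
noncomputable def eT2 (n : ℤ × ℤ) : T2 → ℂ := fun q =>
  Complex.exp (Complex.I * ((n.1 : ℂ) * ((liftT2 q).1 : ℂ) + (n.2 : ℂ) * ((liftT2 q).2 : ℂ)))

/-- The complex `L²` space of the torus. -/
abbrev L2T2 : Type := Lp ℂ 2 (volume : Measure T2)

/-- The squared `L²` norm `∫ |g|²` of a function on the torus. -/
noncomputable def l2sq (g : T2 → ℂ) : ℝ := ∫ q : T2, ‖g q‖ ^ 2

/-- The first Sobolev norm `(‖g‖² + ‖∂g/∂x₁‖² + ‖∂g/∂x₂‖²)^{1/2}`. -/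
noncomputable def sob1 (g : T2 → ℂ) : ℝ :=
  Real.sqrt (l2sq g + l2sq (pd1 g) + l2sq (pd2 g))

/-- A unitary operator `U` on `L²(𝕋²)` "maps `C^∞` functions to `C^∞` functions and
commutes with `∂/∂x₁` and `∂/∂x₂` on them": for every smooth `φ` there is a smooth
`ψ` (representing `U φ`) such that `U` sends (the class of) `φ` to `ψ` and (the
class of) `∂φ/∂x_r` to `∂ψ/∂x_r` for `r = 1, 2`. -/
def SmoothCompat (U : L2T2 ≃ₗᵢ[ℂ] L2T2) : Prop :=
  ∀ φ : T2 → ℂ, SmoothT2 φ → ∃ ψ : T2 → ℂ, SmoothT2 ψ ∧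
    (∀ g : L2T2, ⇑g =ᵐ[volume] φ → ⇑(U g) =ᵐ[volume] ψ) ∧
    (∀ g : L2T2, ⇑g =ᵐ[volume] pd1 φ → ⇑(U g) =ᵐ[volume] pd1 ψ) ∧
    (∀ g : L2T2, ⇑g =ᵐ[volume] pd2 φ → ⇑(U g) =ᵐ[volume] pd2 ψ)

/-- The characterizing properties of the operator `U = ∂_z̄⁻¹ ∘ ∂_z`:
it preserves averages (`∫ U f = ∫ f`) and satisfies `U (∂_z̄ φ) = ∂_z φ`
for every `C^∞` function `φ` on the torus. -/
def CharU (U : L2T2 ≃ₗᵢ[ℂ] L2T2) : Prop :=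
  (∀ f : L2T2, (∫ q : T2, (U f) q) = ∫ q : T2, f q) ∧
  ∀ φ : T2 → ℂ, SmoothT2 φ → ∀ g : L2T2,
    ⇑g =ᵐ[volume] dzbarT2 φ → ⇑(U g) =ᵐ[volume] dzT2 φ

/-- Directional derivative on the torus. -/
noncomputable def pdv (v : ℝ × ℝ) (F : T2 → ℂ) : T2 → ℂ := fun q =>
  fderiv ℝ (F ∘ projT2) (liftT2 q) v

lemma pd1_eq (F : T2 → ℂ) : pd1 F = pdv (1, 0) F := rfl

lemma pd2_eq (F : T2 → ℂ) : pd2 F = pdv (0, 1) F := rfl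

lemma proj_lift (q : T2) : projT2 (liftT2 q) = q := Function.surjInv_eq projT2_surjective q

lemma proj_eq_iff {p r : ℝ × ℝ} (h : projT2 p = projT2 r) (s : ℝ × ℝ) :
    projT2 (s + (p - r)) = projT2 s := by
  simp only [projT2, Prod.mk.injEq] at h ⊢
  simp [h.1, h.2]

lemma fderiv_proj_eq (F : T2 → ℂ) {p r : ℝ × ℝ} (h : projT2 p = projT2 r) :
    fderiv ℝ (F ∘ projT2) p = fderiv ℝ (F ∘ projT2) r := by
  have h1 : (F ∘ projT2) = fun s => (F ∘ projT2) (s + (p - r)) := by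
    funext s
    simp [proj_eq_iff h s]
  have h2 := fderiv_comp_add_right (𝕜 := ℝ) (f := F ∘ projT2) (x := r) (p - r)
  rw [← h1] at h2
  rw [h2]
  congr 1
  abel

lemma pdv_proj (v : ℝ × ℝ) (F : T2 → ℂ) :
    pdv v F ∘ projT2 = fun p => fderiv ℝ (F ∘ projT2) p v := by
  funext p
  simp only [Function.comp, pdv]
  exact congrArg (fun L : ℝ × ℝ →L[ℝ] ℂ => L v) (fderiv_proj_eq F (proj_lift (projT2 p)))

lemma pdv_smooth (v : ℝ × ℝ) {F : T2 → ℂ} (hF : SmoothT2 F) : SmoothT2 (pdv v F) := by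
  unfold SmoothT2 at *
  rw [pdv_proj]
  have := (contDiff_infty_iff_fderiv.1 hF).2
  exact this.clm_apply contDiff_const

lemma projT2_isOpenQuotientMap : IsOpenQuotientMap projT2 :=
  IsOpenQuotientMap.prodMap QuotientAddGroup.isOpenQuotientMap_mk
    QuotientAddGroup.isOpenQuotientMap_mk

lemma SmoothT2.cont {F : T2 → ℂ} (hF : SmoothT2 F) : Continuous F :=
  projT2_isOpenQuotientMap.isQuotientMap.continuous_iff.2 (ContDiff.continuous hF)

lemma SmoothT2.diff {F : T2 → ℂ} (hF : SmoothT2 F) : Differentiable ℝ (F ∘ projT2) :=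
  ContDiff.differentiable hF (by simp)

lemma cont_integrable {F : T2 → ℂ} (hF : Continuous F) : Integrable F (volume : Measure T2) :=
  hF.integrable_of_hasCompactSupport (HasCompactSupport.of_compactSpace F)

lemma integral_pd1 {F : T2 → ℂ} (hF : SmoothT2 F) : ∫ q : T2, pdv (1, 0) F q = 0 := by
  have hc := (pdv_smooth (1, 0) hF).cont
  have hi := cont_integrable hc
  rw [Measure.volume_eq_prod] at hi ⊢
  rw [integral_prod_symm _ hi]
  apply integral_eq_zero_of_ae
  refine Filter.Eventually.of_forall fun y => ?_
  obtain ⟨y, rfl⟩ := QuotientAddGroup.mk_surjective y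
  simp only [Pi.zero_apply]
  rw [← AddCircle.intervalIntegral_preimage (2 * Real.pi) 0]
  have hd : ∀ x : ℝ, HasDerivAt (fun x : ℝ => (F ∘ projT2) (x, y))
      (pdv (1, 0) F (projT2 (x, y))) x := by
    intro x
    have h1 := (hF.diff (x, y)).hasFDerivAt
    have h2 : HasDerivAt (fun x : ℝ => ((x, y) : ℝ × ℝ)) ((1, 0) : ℝ × ℝ) x :=
      (hasDerivAt_id x).prodMk (hasDerivAt_const x y)
    have := h1.comp_hasDerivAt x h2
    have e := congrFun (pdv_proj (1, 0) F) (x, y)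
    simp only [Function.comp] at e
    rw [e]
    exact this
  have := intervalIntegral.integral_eq_sub_of_hasDerivAt (a := 0) (b := 0 + 2 * Real.pi)
    (fun x _ => hd x) (Continuous.intervalIntegrable (by
      refine hc.comp ?_
      exact projT2_isOpenQuotientMap.continuous.comp (by fun_prop)) _ _)
  refine (Eq.trans ?_ this).trans ?_
  · rfl
  · simp only [projT2, Function.comp, zero_add, AddCircle.coe_period]
    simp

lemma integral_pd2 {F : T2 → ℂ} (hF : SmoothT2 F) : ∫ q : T2, pdv (0, 1) F q = 0 := by
  have hc := (pdv_smooth (0, 1) hF).cont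
  have hi := cont_integrable hc
  rw [Measure.volume_eq_prod] at hi ⊢
  rw [integral_prod _ hi]
  apply integral_eq_zero_of_ae
  refine Filter.Eventually.of_forall fun y => ?_
  obtain ⟨y, rfl⟩ := QuotientAddGroup.mk_surjective y
  simp only [Pi.zero_apply]
  rw [← AddCircle.intervalIntegral_preimage (2 * Real.pi) 0]
  have hd : ∀ x : ℝ, HasDerivAt (fun x : ℝ => (F ∘ projT2) (y, x))
      (pdv (0, 1) F (projT2 (y, x))) x := by
    intro x
    have h1 := (hF.diff (y, x)).hasFDerivAt
    have h2 : HasDerivAt (fun x : ℝ => ((y, x) : ℝ × ℝ)) ((0, 1) : ℝ × ℝ) x :=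
      (hasDerivAt_const x y).prodMk (hasDerivAt_id x)
    have := h1.comp_hasDerivAt x h2
    have e := congrFun (pdv_proj (0, 1) F) (y, x)
    simp only [Function.comp] at e
    rw [e]
    exact this
  have := intervalIntegral.integral_eq_sub_of_hasDerivAt (a := 0) (b := 0 + 2 * Real.pi)
    (fun x _ => hd x) (Continuous.intervalIntegrable (by
      refine hc.comp ?_
      exact projT2_isOpenQuotientMap.continuous.comp (by fun_prop)) _ _)
  refine (Eq.trans ?_ this).trans ?_
  · rfl
  · simp only [projT2, Function.comp, zero_add, AddCircle.coe_period]
    simp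

lemma pdv_mul (v : ℝ × ℝ) {F G : T2 → ℂ} (hF : SmoothT2 F) (hG : SmoothT2 G) (q : T2) :
    pdv v (fun q => F q * G q) q = F q * pdv v G q + pdv v F q * G q := by
  have h := ((hF.diff (liftT2 q)).hasFDerivAt.mul (hG.diff (liftT2 q)).hasFDerivAt).fderiv
  have e : ((fun q => F q * G q) ∘ projT2) = (F ∘ projT2) * (G ∘ projT2) := rfl
  simp only [pdv, e, h]
  simp [proj_lift, mul_comm]

/-- The linear form `n₁ x₁ + n₂ x₂` times `i`. -/
noncomputable def lin (n : ℤ × ℤ) : ℝ × ℝ →L[ℝ] ℂ :=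
  (Complex.I * (n.1 : ℂ)) • Complex.ofRealCLM.comp (ContinuousLinearMap.fst ℝ ℝ ℝ) +
  (Complex.I * (n.2 : ℂ)) • Complex.ofRealCLM.comp (ContinuousLinearMap.snd ℝ ℝ ℝ)

lemma lin_apply (n : ℤ × ℤ) (p : ℝ × ℝ) :
    lin n p = Complex.I * ((n.1 : ℂ) * (p.1 : ℂ) + (n.2 : ℂ) * (p.2 : ℂ)) := by
  simp [lin]; ring

lemma fourier_mul_proj (n : ℤ × ℤ) (p : ℝ × ℝ) :
    fourier n.1 (projT2 p).1 * fourier n.2 (projT2 p).2 = Complex.exp (lin n p) := by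
  simp only [projT2, fourier_coe_apply, ← Complex.exp_add, lin_apply]
  congr 1
  have : (Real.pi : ℂ) ≠ 0 := by exact_mod_cast Real.pi_ne_zero
  push_cast
  field_simp

lemma eT2_eq (n : ℤ × ℤ) (q : T2) : eT2 n q = fourier n.1 q.1 * fourier n.2 q.2 := by
  conv_rhs => rw [← proj_lift q]
  rw [fourier_mul_proj, lin_apply]; rfl

lemma eT2_proj (n : ℤ × ℤ) : eT2 n ∘ projT2 = fun p => Complex.exp (lin n p) := by
  funext p
  simp only [Function.comp]
  rw [eT2_eq, fourier_mul_proj]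

lemma eT2_smooth (n : ℤ × ℤ) : SmoothT2 (eT2 n) := by
  unfold SmoothT2
  rw [eT2_proj]
  exact (lin n).contDiff.cexp

lemma eT2_norm (n : ℤ × ℤ) (q : T2) : ‖eT2 n q‖ = 1 := by
  rw [eT2_eq]
  simp [Circle.norm_coe]

lemma hasFDerivAt_exp_lin (n : ℤ × ℤ) (p : ℝ × ℝ) :
    HasFDerivAt (fun p => Complex.exp (lin n p)) (Complex.exp (lin n p) • lin n) p :=
  (lin n).hasFDerivAt.cexp

lemma pdv_eT2 (v : ℝ × ℝ) (n : ℤ × ℤ) (q : T2) : pdv v (eT2 n) q = lin n v * eT2 n q := by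
  simp only [pdv]
  have : eT2 n q = Complex.exp (lin n (liftT2 q)) := by
    rw [← congrFun (eT2_proj n) (liftT2 q)]; simp [proj_lift]
  rw [eT2_proj, (hasFDerivAt_exp_lin n _).fderiv, this]
  simp [mul_comm]

lemma eT2_conj (n : ℤ × ℤ) (q : T2) : (starRingEnd ℂ) (eT2 n q) = eT2 (-n) q := by
  simp only [eT2_eq, map_mul, ← fourier_neg, Prod.fst_neg, Prod.snd_neg]

lemma eT2_mul (m n : ℤ × ℤ) (q : T2) : eT2 (m + n) q = eT2 m q * eT2 n q := by
  simp only [eT2_eq, Prod.fst_add, Prod.snd_add, fourier_add]; ring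

lemma eT2_zero (q : T2) : eT2 0 q = 1 := by
  simp [eT2_eq]

/-- (Unnormalised) Fourier coefficients. -/
noncomputable def cf (F : T2 → ℂ) (n : ℤ × ℤ) : ℂ := ∫ q : T2, eT2 (-n) q * F q

lemma cf_int {F : T2 → ℂ} (hF : Continuous F) (n : ℤ × ℤ) :
    Integrable (fun q => eT2 (-n) q * F q) (volume : Measure T2) :=
  cont_integrable ((eT2_smooth _).cont.mul hF)

lemma cf_pdv_aux (v : ℝ × ℝ) (hv : ∀ F : T2 → ℂ, SmoothT2 F → ∫ q : T2, pdv v F q = 0)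
    {F : T2 → ℂ} (hF : SmoothT2 F) (n : ℤ × ℤ) : cf (pdv v F) n = lin n v * cf F n := by
  have h := hv (fun q => eT2 (-n) q * F q) (ContDiff.mul (eT2_smooth _) hF)
  simp only [pdv_mul v (eT2_smooth (-n)) hF, pdv_eT2] at h
  have e : ∀ q, lin (-n) v * eT2 (-n) q * F q = lin (-n) v * (eT2 (-n) q * F q) :=
    fun q => mul_assoc _ _ _
  simp only [e] at h
  rw [integral_add (cf_int (pdv_smooth v hF).cont n) ((cf_int hF.cont n).const_mul _),
    integral_const_mul] at h
  have e2 : lin (-n) v = - lin n v := by simp [lin_apply]; ring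
  rw [e2] at h
  unfold cf
  linear_combination h

lemma cf_pd1 {F : T2 → ℂ} (hF : SmoothT2 F) (n : ℤ × ℤ) :
    cf (pd1 F) n = Complex.I * n.1 * cf F n := by
  rw [pd1_eq, cf_pdv_aux _ (fun F hF => integral_pd1 hF) hF, lin_apply]; simp

lemma cf_pd2 {F : T2 → ℂ} (hF : SmoothT2 F) (n : ℤ × ℤ) :
    cf (pd2 F) n = Complex.I * n.2 * cf F n := by
  rw [pd2_eq, cf_pdv_aux _ (fun F hF => integral_pd2 hF) hF, lin_apply]; simp

lemma pd1_eT2 (n : ℤ × ℤ) (q : T2) : pd1 (eT2 n) q = Complex.I * n.1 * eT2 n q := by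
  rw [pd1_eq, pdv_eT2, lin_apply]; simp

lemma pd2_eT2 (n : ℤ × ℤ) (q : T2) : pd2 (eT2 n) q = Complex.I * n.2 * eT2 n q := by
  rw [pd2_eq, pdv_eT2, lin_apply]; simp

lemma cf_const_mul (c : ℂ) (F : T2 → ℂ) (n : ℤ × ℤ) : cf (fun q => c * F q) n = c * cf F n := by
  unfold cf
  rw [← integral_const_mul]
  congr 1
  funext q
  ring

lemma cf_eT2 (m n : ℤ × ℤ) : cf (eT2 m) n = if n = m then (2 * Real.pi : ℂ) ^ 2 else 0 := by
  split_ifs with h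
  · subst h
    unfold cf
    simp only [← eT2_mul, neg_add_cancel, eT2_zero]
    have : (volume : Measure T2).real Set.univ = (2 * Real.pi) ^ 2 := by
      rw [Measure.volume_eq_prod, measureReal_def, ← Set.univ_prod_univ, Measure.prod_prod,
        AddCircle.measure_univ, ENNReal.toReal_mul,
        ENNReal.toReal_ofReal (by positivity)]
      ring
    rw [integral_const, this]
    simp
  · have h1 := cf_pd1 (eT2_smooth m) n
    have h2 := cf_pd2 (eT2_smooth m) n
    rw [show pd1 (eT2 m) = fun q => Complex.I * m.1 * eT2 m q from funext (pd1_eT2 m),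
      cf_const_mul] at h1
    rw [show pd2 (eT2 m) = fun q => Complex.I * m.2 * eT2 m q from funext (pd2_eT2 m),
      cf_const_mul] at h2
    by_contra hne
    apply h
    have h1 := mul_left_cancel₀ Complex.I_ne_zero (mul_right_cancel₀ hne h1)
    have h2 := mul_left_cancel₀ Complex.I_ne_zero (mul_right_cancel₀ hne h2)
    exact Prod.ext (by exact_mod_cast h1.symm) (by exact_mod_cast h2.symm)

/-- The character as a bundled continuous map. -/
noncomputable def eC (n : ℤ × ℤ) : C(T2, ℂ) := ⟨eT2 n, (eT2_smooth n).cont⟩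

/-- The star subalgebra generated by the characters. -/
noncomputable def algE : StarSubalgebra ℂ C(T2, ℂ) where
  toSubalgebra := Algebra.adjoin ℂ (Set.range eC)
  star_mem' := by
    change Algebra.adjoin ℂ (Set.range eC) ≤ star (Algebra.adjoin ℂ (Set.range eC))
    refine Algebra.adjoin_le ?_
    rintro - ⟨n, rfl⟩
    exact Algebra.subset_adjoin ⟨-n, ContinuousMap.ext fun q => (eT2_conj n q).symm⟩

lemma algE_coe : Subalgebra.toSubmodule algE.toSubalgebra = Submodule.span ℂ (Set.range eC) := by
  apply Algebra.adjoin_eq_span_of_subset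
  refine Set.Subset.trans ?_ Submodule.subset_span
  intro x hx
  refine Submonoid.closure_induction (fun _ => id) ⟨0, ?_⟩ ?_ hx
  · ext1 z; exact eT2_zero z
  · rintro - - - - ⟨m, rfl⟩ ⟨n, rfl⟩
    refine ⟨m + n, ?_⟩
    ext1 z
    exact eT2_mul m n z

lemma algE_sep : algE.SeparatesPoints := by
  intro x y hxy
  have hinj := AddCircle.injective_toCircle (T := 2 * Real.pi) (by positivity)
  by_cases h : x.1 = y.1
  · have h2 : x.2 ≠ y.2 := fun h2 => hxy (Prod.ext h h2)
    refine ⟨_, ⟨eC (0, 1), Algebra.subset_adjoin ⟨(0, 1), rfl⟩, rfl⟩, ?_⟩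
    change eT2 _ x ≠ eT2 _ y
    contrapose h2
    rw [eT2_eq, eT2_eq, fourier_zero, fourier_zero, one_mul, one_mul, fourier_one, fourier_one] at h2
    exact hinj (Circle.ext h2)
  · refine ⟨_, ⟨eC (1, 0), Algebra.subset_adjoin ⟨(1, 0), rfl⟩, rfl⟩, ?_⟩
    change eT2 _ x ≠ eT2 _ y
    contrapose h
    rw [eT2_eq, eT2_eq, fourier_zero, fourier_zero, mul_one, mul_one, fourier_one, fourier_one] at h
    exact hinj (Circle.ext h)

lemma span_eC : (Submodule.span ℂ (Set.range eC)).topologicalClosure = ⊤ := by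
  rw [← algE_coe]
  exact congr_arg (Subalgebra.toSubmodule <| StarSubalgebra.toSubalgebra ·)
    (ContinuousMap.starSubalgebra_topologicalClosure_eq_top_of_separatesPoints algE algE_sep)

/-- The class of the character in `L²`. -/
noncomputable def eL (n : ℤ × ℤ) : L2T2 := ContinuousMap.toLp (E := ℂ) 2 volume ℂ (eC n)

lemma eL_coe (n : ℤ × ℤ) : ⇑(eL n) =ᵐ[volume] eT2 n :=
  ContinuousMap.coeFn_toLp (𝕜 := ℂ) volume (eC n)

lemma span_eL : (Submodule.span ℂ (Set.range eL)).topologicalClosure = ⊤ := by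
  convert!
    (ContinuousMap.toLp_denseRange ℂ (volume : Measure T2) ℂ
      (p := 2) (by simp)).topologicalClosure_map_submodule span_eC
  rw [Submodule.map_span]
  unfold eL
  rw [Set.range_comp']
  simp only [ContinuousLinearMap.coe_coe]

lemma inner_eL (n : ℤ × ℤ) (g : L2T2) : inner ℂ (eL n) g = cf g n := by
  rw [L2.inner_def]
  unfold cf
  apply integral_congr_ae
  filter_upwards [eL_coe n] with q hq
  rw [hq, ← eT2_conj]
  simp [mul_comm]

lemma cf_congr {F G : T2 → ℂ} (h : F =ᵐ[volume] G) (n : ℤ × ℤ) : cf F n = cf G n := by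
  unfold cf
  apply integral_congr_ae
  filter_upwards [h] with q hq
  rw [hq]

lemma inner_eL_eL (n m : ℤ × ℤ) :
    inner ℂ (eL n) (eL m) = if n = m then (2 * Real.pi : ℂ) ^ 2 else 0 := by
  rw [inner_eL, cf_congr (eL_coe m), cf_eT2]

/-- Normalised characters times unimodular constants. -/
noncomputable def bv (c : ℤ × ℤ → ℂ) (n : ℤ × ℤ) : L2T2 := (c n * (2 * Real.pi : ℂ)⁻¹) • eL n

lemma two_pi_ne : (2 * Real.pi : ℂ) ≠ 0 := by
  exact_mod_cast (by positivity : (2 * Real.pi : ℝ) ≠ 0)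

lemma bv_orth (c : ℤ × ℤ → ℂ) (hc : ∀ n, ‖c n‖ = 1) : Orthonormal ℂ (bv c) := by
  rw [orthonormal_iff_ite]
  intro n m
  unfold bv
  rw [inner_smul_left, inner_smul_right, inner_eL_eL]
  split_ifs with h
  · subst h
    have h1 : (starRingEnd ℂ) (c n) * c n = 1 := by
      rw [mul_comm, Complex.mul_conj, Complex.normSq_eq_norm_sq, hc]; simp
    have := two_pi_ne
    simp only [map_mul, map_inv₀, Complex.conj_ofReal, map_ofNat]
    field_simp
    linear_combination h1
  · simp

lemma bv_span (c : ℤ × ℤ → ℂ) (hc : ∀ n, ‖c n‖ = 1) :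
    ⊤ ≤ (Submodule.span ℂ (Set.range (bv c))).topologicalClosure := by
  rw [← span_eL]
  apply Submodule.topologicalClosure_mono
  rw [Submodule.span_le]
  rintro - ⟨n, rfl⟩
  have hn : c n ≠ 0 := by
    intro h; have := hc n; simp [h] at this
  have h2 := two_pi_ne
  have : eL n = (c n * (2 * Real.pi : ℂ)⁻¹)⁻¹ • bv c n := by
    unfold bv
    rw [smul_smul, inv_mul_cancel₀ (mul_ne_zero hn (inv_ne_zero h2)), one_smul]
  rw [this]
  exact Submodule.smul_mem _ _ (Submodule.subset_span ⟨n, rfl⟩)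

/-- The Hilbert basis. -/
noncomputable def hb (c : ℤ × ℤ → ℂ) (hc : ∀ n, ‖c n‖ = 1) : HilbertBasis (ℤ × ℤ) ℂ L2T2 :=
  HilbertBasis.mk (bv_orth c hc) (bv_span c hc)

lemma hb_coe (c : ℤ × ℤ → ℂ) (hc : ∀ n, ‖c n‖ = 1) (n : ℤ × ℤ) : hb c hc n = bv c n := by
  unfold hb; rw [HilbertBasis.coe_mk]

/-- The multiplier. -/
noncomputable def mu (n : ℤ × ℤ) : ℂ :=
  if n = 0 then 1 else ((n.1 : ℂ) - Complex.I * (n.2 : ℂ)) / ((n.1 : ℂ) + Complex.I * (n.2 : ℂ))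

lemma den_ne {n : ℤ × ℤ} (hn : n ≠ 0) : (n.1 : ℂ) + Complex.I * (n.2 : ℂ) ≠ 0 := by
  intro h
  have h1 := congrArg Complex.re h
  have h2 := congrArg Complex.im h
  simp at h1 h2
  exact hn (Prod.ext h1 h2)

lemma mu_norm (n : ℤ × ℤ) : ‖mu n‖ = 1 := by
  unfold mu
  split_ifs with h
  · simp
  · have e : (n.1 : ℂ) - Complex.I * (n.2 : ℂ) =
        (starRingEnd ℂ) ((n.1 : ℂ) + Complex.I * (n.2 : ℂ)) := by
      simp [sub_eq_add_neg]
    rw [e, norm_div, Complex.norm_conj]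
    exact div_self (norm_ne_zero_iff.2 (den_ne h))

lemma one_norm' : ∀ n : ℤ × ℤ, ‖(fun _ => (1 : ℂ)) n‖ = 1 := by simp

/-- The operator. -/
noncomputable def UU : L2T2 ≃ₗᵢ[ℂ] L2T2 :=
  (hb (fun _ => 1) one_norm').repr.trans (hb mu mu_norm).repr.symm

lemma UU_cf (g : L2T2) (n : ℤ × ℤ) : cf (UU g) n = mu n * cf g n := by
  have h : (hb mu mu_norm).repr (UU g) = (hb (fun _ => 1) one_norm').repr g := by
    simp [UU]
  have h := congrArg (fun f => f n) h
  simp only [HilbertBasis.repr_apply_apply, hb_coe, bv, inner_smul_left, inner_eL] at h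
  have h1 : mu n * (starRingEnd ℂ) (mu n) = 1 := by
    rw [Complex.mul_conj, Complex.normSq_eq_norm_sq, mu_norm]; simp
  have h2 := two_pi_ne
  simp only [map_mul, map_inv₀, Complex.conj_ofReal, map_ofNat, map_one] at h
  field_simp at h
  linear_combination (mu n) * h - (cf (UU g) n) * h1

lemma ext_cf {f g : L2T2} (h : ∀ n, cf f n = cf g n) : f = g := by
  apply (hb (fun _ => 1) one_norm').repr.injective
  ext n
  simp only [HilbertBasis.repr_apply_apply, hb_coe, bv, inner_smul_left, inner_eL, h]

lemma UU_key {F G : T2 → ℂ} (hG : Continuous G) (h : ∀ n, cf G n = mu n * cf F n)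
    {g : L2T2} (hg : ⇑g =ᵐ[volume] F) : ⇑(UU g) =ᵐ[volume] G := by
  have e := ContinuousMap.coeFn_toLp (𝕜 := ℂ) (p := 2) (volume : Measure T2) (⟨G, hG⟩ : C(T2, ℂ))
  have : UU g = ContinuousMap.toLp (E := ℂ) 2 volume ℂ (⟨G, hG⟩ : C(T2, ℂ)) := by
    apply ext_cf
    intro n
    rw [UU_cf, cf_congr e, cf_congr hg]
    exact (h n).symm
  rw [this]
  exact e

lemma cf_add {F G : T2 → ℂ} (hF : Continuous F) (hG : Continuous G) (n : ℤ × ℤ) :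
    cf (fun q => F q + G q) n = cf F n + cf G n := by
  unfold cf
  rw [← integral_add (cf_int hF n) (cf_int hG n)]
  simp only [mul_add]

lemma pd1_cont {F : T2 → ℂ} (hF : SmoothT2 F) : Continuous (pd1 F) := (pdv_smooth (1, 0) hF).cont

lemma pd2_cont {F : T2 → ℂ} (hF : SmoothT2 F) : Continuous (pd2 F) := (pdv_smooth (0, 1) hF).cont

lemma cf_dz {F : T2 → ℂ} (hF : SmoothT2 F) (n : ℤ × ℤ) :
    cf (dzT2 F) n = Complex.I / 2 * (n.1 - Complex.I * n.2) * cf F n := by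
  have : dzT2 F = fun q => (1 / 2 : ℂ) * pd1 F q + (-Complex.I / 2) * pd2 F q := by
    funext q; simp only [dzT2]; ring
  rw [this, cf_add ((pd1_cont hF).const_mul _) ((pd2_cont hF).const_mul _),
    cf_const_mul, cf_const_mul, cf_pd1 hF, cf_pd2 hF]
  ring

lemma cf_dzbar {F : T2 → ℂ} (hF : SmoothT2 F) (n : ℤ × ℤ) :
    cf (dzbarT2 F) n = Complex.I / 2 * (n.1 + Complex.I * n.2) * cf F n := by
  have : dzbarT2 F = fun q => (1 / 2 : ℂ) * pd1 F q + (Complex.I / 2) * pd2 F q := by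
    funext q; simp only [dzbarT2]; ring
  rw [this, cf_add ((pd1_cont hF).const_mul _) ((pd2_cont hF).const_mul _),
    cf_const_mul, cf_const_mul, cf_pd1 hF, cf_pd2 hF]
  ring

lemma UU_char : CharU UU := by
  constructor
  · intro f
    have h := UU_cf f 0
    simpa [cf, eT2_zero, mu] using h
  · intro φ hφ g hg
    refine UU_key ?_ (fun n => ?_) hg
    · unfold dzT2
      exact ((pd1_cont hφ).sub ((pd2_cont hφ).const_mul _)).div_const _
    · rw [cf_dz hφ, cf_dzbar hφ]
      unfold mu
      split_ifs with h
      · subst h; simp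
      · have := den_ne h
        field_simp

lemma UU_e (n : ℤ × ℤ) (g : L2T2) (hg : ⇑g =ᵐ[volume] eT2 n) :
    ⇑(UU g) =ᵐ[volume] fun q => mu n * eT2 n q := by
  refine UU_key ((eT2_smooth n).cont.const_mul _) (fun m => ?_) hg
  rw [cf_const_mul, cf_eT2]
  split_ifs with h
  · rw [h]
  · simp

lemma char_e {U : L2T2 ≃ₗᵢ[ℂ] L2T2} (hU : CharU U) (n : ℤ × ℤ) : U (eL n) = mu n • eL n := by
  by_cases hn : n = 0
  · subst hn
    have h1 : inner ℂ (eL 0) (U (eL 0)) = inner ℂ (eL 0) (eL 0) := by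
      rw [inner_eL, inner_eL]
      simpa [cf, eT2_zero] using hU.1 (eL 0)
    have h2 : ‖U (eL 0) - eL 0‖ ^ 2 = 0 := by
      rw [@norm_sub_sq ℂ, ← inner_conj_symm, h1, U.norm_map, inner_conj_symm,
        inner_self_eq_norm_sq]
      ring
    have h3 : U (eL 0) - eL 0 = 0 := by simpa using h2
    rw [sub_eq_zero.1 h3]
    simp [mu]
  · have hd := den_ne hn
    set k : ℂ := 2 / (Complex.I * ((n.1 : ℂ) + Complex.I * (n.2 : ℂ))) with hk
    have hs : SmoothT2 (fun q => k * eT2 n q) := ContDiff.mul contDiff_const (eT2_smooth n)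
    have hsc : SmoothT2 (fun _ : T2 => k) := contDiff_const
    have hz : ∀ v q, pdv v (fun _ : T2 => k) q = 0 := by
      intro v q
      have : ((fun _ : T2 => k) ∘ projT2) = fun _ => k := rfl
      simp [pdv, this]
    have p1 : ∀ q, pd1 (fun q => k * eT2 n q) q = k * (Complex.I * n.1 * eT2 n q) := by
      intro q
      rw [pd1_eq, pdv_mul _ hsc (eT2_smooth n), hz, ← pd1_eq, pd1_eT2]; ring
    have p2 : ∀ q, pd2 (fun q => k * eT2 n q) q = k * (Complex.I * n.2 * eT2 n q) := by
      intro q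
      rw [pd2_eq, pdv_mul _ hsc (eT2_smooth n), hz, ← pd2_eq, pd2_eT2]; ring
    have hI := Complex.I_ne_zero
    have e1 : dzbarT2 (fun q => k * eT2 n q) = eT2 n := by
      funext q
      simp only [dzbarT2, p1, p2]
      rw [hk]
      field_simp
    have e2 : dzT2 (fun q => k * eT2 n q) = fun q => mu n * eT2 n q := by
      funext q
      simp only [dzT2, p1, p2, mu, if_neg hn]
      rw [hk]
      field_simp
    have h := hU.2 _ hs (eL n) (by rw [e1]; exact eL_coe n)
    rw [e2] at h
    apply Lp.ext
    filter_upwards [h, Lp.coeFn_smul (mu n) (eL n), eL_coe n] with q h1 h2 h3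
    rw [h1, h2, Pi.smul_apply, h3, smul_eq_mul]

lemma char_unique {U : L2T2 ≃ₗᵢ[ℂ] L2T2} (hU : CharU U) : U = UU := by
  have hd : Dense (Submodule.span ℂ (Set.range eL) : Set L2T2) :=
    Submodule.dense_iff_topologicalClosure_eq_top.2 span_eL
  have : (U.toContinuousLinearEquiv : L2T2 →L[ℂ] L2T2) =
      (UU.toContinuousLinearEquiv : L2T2 →L[ℂ] L2T2) := by
    apply ContinuousLinearMap.ext_on hd
    rintro - ⟨n, rfl⟩
    exact (char_e hU n).trans (char_e UU_char n).symm
  ext1 f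
  exact congrArg (fun L : L2T2 →L[ℂ] L2T2 => L f) this

/-- Rapid decay. -/
def Rapid (a : ℤ × ℤ → ℂ) : Prop :=
  ∀ j k : ℕ, Summable fun n : ℤ × ℤ => |(n.1 : ℝ)| ^ j * |(n.2 : ℝ)| ^ k * ‖a n‖

lemma Rapid.mul1 {a : ℤ × ℤ → ℂ} (ha : Rapid a) (v : ℝ × ℝ) :
    Rapid (fun n => lin n v * a n) := by
  intro j k
  have h := ((ha (j + 1) k).mul_left |v.1|).add ((ha j (k + 1)).mul_left |v.2|)
  refine Summable.of_nonneg_of_le (fun n => by positivity) (fun n => ?_) h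
  have hl : ‖lin n v‖ ≤ |(n.1 : ℝ)| * |v.1| + |(n.2 : ℝ)| * |v.2| := by
    rw [lin_apply, norm_mul, Complex.norm_I, one_mul]
    refine (norm_add_le _ _).trans (le_of_eq ?_)
    simp
  rw [norm_mul]
  calc _ ≤ |(n.1 : ℝ)| ^ j * |(n.2 : ℝ)| ^ k *
        ((|(n.1 : ℝ)| * |v.1| + |(n.2 : ℝ)| * |v.2|) * ‖a n‖) := by gcongr
    _ = _ := by ring

lemma exp_lin_norm (n : ℤ × ℤ) (p : ℝ × ℝ) : ‖Complex.exp (lin n p)‖ = 1 := by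
  rw [← congrFun (eT2_proj n) p]; exact eT2_norm _ _

lemma lin_norm (n : ℤ × ℤ) : ‖lin n‖ ≤ |(n.1 : ℝ)| + |(n.2 : ℝ)| := by
  refine ContinuousLinearMap.opNorm_le_bound _ (by positivity) fun v => ?_
  rw [lin_apply, norm_mul, Complex.norm_I, one_mul]
  refine (norm_add_le _ _).trans ?_
  have h1 : |v.1| ≤ ‖v‖ := norm_fst_le v
  have h2 : |v.2| ≤ ‖v‖ := norm_snd_le v
  simp only [norm_mul, Complex.norm_intCast, Complex.norm_real, Real.norm_eq_abs]
  rw [add_mul]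
  gcongr

lemma Rapid.summ {a : ℤ × ℤ → ℂ} (ha : Rapid a) : Summable fun n => ‖a n‖ := by
  simpa using ha 0 0

lemma Rapid.hasFDeriv {a : ℤ × ℤ → ℂ} (ha : Rapid a) (p : ℝ × ℝ) :
    HasFDerivAt (fun p => ∑' n, a n * Complex.exp (lin n p))
      (∑' n, a n • (Complex.exp (lin n p) • lin n)) p ∧
    Summable (fun n => a n • (Complex.exp (lin n p) • lin n)) := by
  have hu : Summable (fun n : ℤ × ℤ => ‖a n‖ * (|(n.1 : ℝ)| + |(n.2 : ℝ)|)) := by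
    have := (ha 1 0).add (ha 0 1)
    refine this.congr fun n => ?_
    simp; ring
  have hb : ∀ n (p : ℝ × ℝ), ‖a n • (Complex.exp (lin n p) • lin n)‖ ≤
      ‖a n‖ * (|(n.1 : ℝ)| + |(n.2 : ℝ)|) := by
    intro n p
    rw [norm_smul, norm_smul, exp_lin_norm, one_mul]
    gcongr
    exact lin_norm n
  refine ⟨hasFDerivAt_tsum hu (fun n p => ?_) hb (x₀ := p) ?_ p,
    Summable.of_norm_bounded hu (fun n => hb n p)⟩
  · exact (hasFDerivAt_exp_lin n p).const_mul (a n)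
  · refine Summable.of_norm_bounded ha.summ (fun n => ?_)
    rw [norm_mul, exp_lin_norm, mul_one]

lemma Rapid.contDiff (k : ℕ) : ∀ {a : ℤ × ℤ → ℂ}, Rapid a →
    ContDiff ℝ k (fun p => ∑' n, a n * Complex.exp (lin n p)) := by
  induction k with
  | zero =>
    intro a ha
    rw [Nat.cast_zero, contDiff_zero]
    exact Differentiable.continuous (𝕜 := ℝ)
      fun p => (ha.hasFDeriv p).1.differentiableAt
  | succ k ih =>
    intro a ha
    rw [Nat.cast_succ, contDiff_succ_iff_fderiv_apply]
    refine ⟨fun p => (ha.hasFDeriv p).1.differentiableAt, by simp, fun v => ?_⟩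
    have : (fun p => fderiv ℝ (fun p => ∑' n, a n * Complex.exp (lin n p)) p v) =
        fun p => ∑' n, (lin n v * a n) * Complex.exp (lin n p) := by
      funext p
      rw [(ha.hasFDeriv p).1.fderiv]
      have h := (ContinuousLinearMap.apply ℝ ℂ v).map_tsum (ha.hasFDeriv p).2
      refine Eq.trans h ?_
      congr 1
      funext n
      simp
      ring
    rw [this]
    exact ih (ha.mul1 v)

lemma Rapid.smooth {a : ℤ × ℤ → ℂ} (ha : Rapid a) : SmoothT2 (fun q => ∑' n, a n * eT2 n q) := by
  unfold SmoothT2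
  have : ((fun q => ∑' n, a n * eT2 n q) ∘ projT2) =
      fun p => ∑' n, a n * Complex.exp (lin n p) := by
    funext p
    simp only [Function.comp]
    congr 1
    funext n
    rw [← congrFun (eT2_proj n) p]; rfl
  rw [this]
  exact contDiff_infty.2 fun k => Rapid.contDiff k ha

lemma Rapid.cf_eq {a : ℤ × ℤ → ℂ} (ha : Rapid a) (m : ℤ × ℤ) :
    cf (fun q => ∑' n, a n * eT2 n q) m = (2 * Real.pi : ℂ) ^ 2 * a m := by
  have h1 : ∀ n, ∫ q : T2, eT2 (-m) q * (a n * eT2 n q) = a n * cf (eT2 n) m := by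
    intro n
    exact cf_const_mul (a n) (eT2 n) m
  have hint := hasSum_integral_of_summable_integral_norm
    (F := fun n q => eT2 (-m) q * (a n * eT2 n q)) (μ := (volume : Measure T2))
    (fun n => cf_int ((eT2_smooth n).cont.const_mul _) m)
    (by
      simp only [norm_mul, eT2_norm, one_mul, mul_one, integral_const]
      exact ha.summ.const_smul _)
  have h2 : cf (fun q => ∑' n, a n * eT2 n q) m =
      ∫ q : T2, ∑' n, eT2 (-m) q * (a n * eT2 n q) := by
    unfold cf
    simp only [tsum_mul_left]
  rw [h2, ← hint.tsum_eq]
  simp only [h1, cf_eT2]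
  rw [tsum_eq_single m (fun n hn => by rw [if_neg (Ne.symm hn), mul_zero])]
  rw [if_pos rfl, mul_comm]

lemma cf_bound (F : T2 → ℂ) : ∃ C : ℝ, ∀ n, ‖cf F n‖ ≤ C := by
  refine ⟨∫ q : T2, ‖F q‖, fun n => ?_⟩
  refine (norm_integral_le_integral_norm _).trans (le_of_eq ?_)
  simp [eT2_norm]

lemma cf_bound2 (j k : ℕ) : ∀ {F : T2 → ℂ}, SmoothT2 F →
    ∃ C : ℝ, ∀ n : ℤ × ℤ, |(n.1 : ℝ)| ^ j * |(n.2 : ℝ)| ^ k * ‖cf F n‖ ≤ C := by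
  induction j with
  | zero =>
    induction k with
    | zero => intro F _; simpa using cf_bound F
    | succ k ih =>
      intro F hF
      obtain ⟨C, hC⟩ := ih (pdv_smooth (0, 1) hF)
      refine ⟨C, fun n => (le_of_eq ?_).trans (hC n)⟩
      rw [← pd2_eq, cf_pd2 hF]
      simp only [norm_mul, Complex.norm_I, Complex.norm_intCast]
      ring
  | succ j ih =>
    intro F hF
    obtain ⟨C, hC⟩ := ih (pdv_smooth (1, 0) hF)
    refine ⟨C, fun n => (le_of_eq ?_).trans (hC n)⟩
    rw [← pd1_eq, cf_pd1 hF]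
    simp only [norm_mul, Complex.norm_I, Complex.norm_intCast]
    ring

lemma summable_int_inv : Summable fun n : ℤ => (1 + |(n : ℝ)| ^ 2)⁻¹ := by
  have h : Summable fun n : ℤ => 1 / |(n : ℝ)| ^ 2 := by
    simpa [sq_abs] using (Real.summable_one_div_int_pow (p := 2)).2 (by norm_num)
  refine Summable.of_norm_bounded_eventually h ?_
  have : ∀ᶠ n : ℤ in Filter.cofinite, n ≠ 0 := by
    exact (Set.finite_singleton (0 : ℤ)).eventually_cofinite_notMem
  filter_upwards [this] with n hn
  have hp : 0 < |(n : ℝ)| := abs_pos.2 (by exact_mod_cast hn)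
  rw [Real.norm_of_nonneg (by positivity), one_div]
  gcongr
  linarith

lemma cf_rapid {F : T2 → ℂ} (hF : SmoothT2 F) : Rapid (cf F) := by
  intro j k
  obtain ⟨C1, h1⟩ := cf_bound2 j k hF
  obtain ⟨C2, h2⟩ := cf_bound2 (j + 2) k hF
  obtain ⟨C3, h3⟩ := cf_bound2 j (k + 2) hF
  obtain ⟨C4, h4⟩ := cf_bound2 (j + 2) (k + 2) hF
  have hs := (summable_int_inv.mul_of_nonneg summable_int_inv
    (fun _ => by positivity) (fun _ => by positivity)).mul_left (C1 + C2 + C3 + C4)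
  refine Summable.of_nonneg_of_le (fun n => by positivity) (fun n => ?_) hs
  have hx : 0 < 1 + |(n.1 : ℝ)| ^ 2 := by positivity
  have hy : 0 < 1 + |(n.2 : ℝ)| ^ 2 := by positivity
  rw [← mul_inv, ← div_eq_mul_inv, le_div_iff₀ (by positivity)]
  have e := add_le_add (add_le_add (add_le_add (h1 n) (h2 n)) (h3 n)) (h4 n)
  refine (le_of_eq ?_).trans e
  ring

lemma UU_smooth : SmoothCompat UU := by
  intro φ hφ
  have ha : Rapid (fun n => ((2 * Real.pi : ℂ) ^ 2)⁻¹ * (mu n * cf φ n)) := by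
    intro j k
    refine ((cf_rapid hφ j k).mul_left ‖((2 * Real.pi : ℂ) ^ 2)⁻¹‖).congr fun n => ?_
    simp only [norm_mul, mu_norm]
    ring
  have hc := ha.cf_eq
  have hs := ha.smooth
  set ψ : T2 → ℂ := fun q => ∑' n, ((2 * Real.pi : ℂ) ^ 2)⁻¹ * (mu n * cf φ n) * eT2 n q with hψ
  have hc' : ∀ n, cf ψ n = mu n * cf φ n := by
    intro n
    rw [hc, mul_inv_cancel_left₀ (pow_ne_zero 2 two_pi_ne)]
  refine ⟨ψ, hs, fun g hg => UU_key hs.cont hc' hg,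
    fun g hg => UU_key (pd1_cont hs) (fun n => ?_) hg,
    fun g hg => UU_key (pd2_cont hs) (fun n => ?_) hg⟩
  · rw [cf_pd1 hs, cf_pd1 hφ, hc']; ring
  · rw [cf_pd2 hs, cf_pd2 hφ, hc']; ring

/-- **The operator `U = ∂_z̄⁻¹ ∘ ∂_z` on `L²(𝕋²)`.** There is a unique unitary
operator `U` on `L²(𝕋²)` preserving averages with `U ∂_z̄ φ = ∂_z φ` for all smooth
`φ`. Moreover `U` maps `C^∞` functions to `C^∞` functions, commutes with `∂/∂x₁`,
`∂/∂x₂` on them, and `U e_n = ((n₁ − i n₂)/(n₁ + i n₂)) e_n` (with `U e₀ = e₀`). -/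
theorem exists_unique_U :
    ∃ U : L2T2 ≃ₗᵢ[ℂ] L2T2, CharU U ∧
      SmoothCompat U ∧
      (∀ n : ℤ × ℤ, ∀ g : L2T2, ⇑g =ᵐ[volume] eT2 n →
        ⇑(U g) =ᵐ[volume] fun q =>
          (if n = 0 then 1 else ((n.1 : ℂ) - Complex.I * (n.2 : ℂ)) /
            ((n.1 : ℂ) + Complex.I * (n.2 : ℂ))) * eT2 n q) ∧
      ∀ U' : L2T2 ≃ₗᵢ[ℂ] L2T2, CharU U' → U' = U := by
  exact ⟨UU, UU_char, UU_smooth, UU_e, fun U hU => char_unique hU⟩
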